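/- Let d ≥ 2 and suppose α₀, α₁, α₂ ≥ 0 satisfy α₁ + α₂ > (d−1)/2 and: α₀ = α₁ + α₂ − (d−1)/2 if max{α₁,α₂} < (d−1)/2; α₀ < min{α₁,α₂} if max{α₁,α₂} = (d−1)/2; α₀ = min{α₁,α₂} if max{α₁,α₂} > (d−1)/2. Then there is a constant c such that for every Hilbert–Schmidt operator γ₀ on L²(ℝ^d), ‖ ρ_{e^{itΔ} γ₀ e^{−itΔ}} ‖_{L²_t(ℝ; L^{2d/(d−1)}_x)} ≤ c ‖⟨∇⟩^{α₂} γ₀ ⟨∇⟩^{α₁}‖_{𝔖²}. (This follows from the density Strichartz estimate ‖|∇|^{1/2} ρ_{e^{itΔ}γ₀e^{−itΔ}}‖_{L²_t H^{α₀}_x} ≲ ‖⟨∇⟩^{α₁} γ₀ ⟨∇⟩^{α₂}‖_{𝔖²} together with the Sobolev inequality.) -/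

import Mathlib

open MeasureTheory Complex Filter
open scoped ENNReal NNReal RealInnerProductSpace Topology ComplexConjugate

noncomputable section

/-- `d`-dimensional Euclidean space `ℝ^d`. -/
abbrev Vd (d : ℕ) := EuclideanSpace ℝ (Fin d)

/-- The Japanese bracket `⟨ξ⟩ = (1 + |ξ|²)^{1/2}`. -/
noncomputable def jb {d : ℕ} (ξ : Vd d) : ℝ := (1 + ‖ξ‖ ^ 2) ^ ((1 : ℝ) / 2)

/-- Fourier transform, with the paper's convention `ĥ(ξ) = ∫ e^{-i x·ξ} h(x) dx`. -/
noncomputable def ft {d : ℕ} (h : Vd d → ℂ) (ξ : Vd d) : ℂ :=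
  ∫ x : Vd d, Complex.exp (-(Complex.I * Complex.ofReal (⟪x, ξ⟫))) * h x

/-- Inverse Fourier transform `ǧ(x) = (2π)^{-d} ∫ e^{i x·ξ} g(ξ) dξ`. -/
noncomputable def invFt {d : ℕ} (h : Vd d → ℂ) (x : Vd d) : ℂ :=
  (((2 * Real.pi) ^ d)⁻¹ : ℝ) • ∫ ξ : Vd d, Complex.exp (Complex.I * Complex.ofReal (⟪x, ξ⟫)) * h ξ

/-- The space Fourier transform (at frequency `ξ`, time `t`) of the density of
`e^{itΔ} γ₀ e^{-itΔ}`, expressed via `G = γ̂₀`, the `2d`-dimensional Fourier transform of the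
integral kernel of `γ₀`:  `ρ̂(t,ξ) = (2π)^{-d} ∫ e^{-it(|η|²-|ξ-η|²)} G(η, ξ-η) dη`. -/
noncomputable def densFT {d : ℕ} (G : Vd d × Vd d → ℂ) (t : ℝ) (ξ : Vd d) : ℂ :=
  (((2 * Real.pi) ^ d)⁻¹ : ℝ) •
    ∫ η : Vd d, Complex.exp (-(Complex.I * Complex.ofReal (t * (‖η‖ ^ 2 - ‖ξ - η‖ ^ 2)))) * G (η, ξ - η)

/-- `‖ |∇|^s ρ_{e^{itΔ}γ₀e^{-itΔ}} ‖_{L²_t(ℝ; H^{α₀}_x)}`, computed on the space Fourier side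
(by Plancherel) from `G = γ̂₀`. -/
noncomputable def densStriNorm {d : ℕ} (s α₀ : ℝ) (G : Vd d × Vd d → ℂ) : ℝ≥0∞ :=
  (∫⁻ t : ℝ, ∫⁻ ξ : Vd d,
      ENNReal.ofReal (‖ξ‖ ^ (2 * s) * jb ξ ^ (2 * α₀)) * (‖densFT G t ξ‖₊ : ℝ≥0∞) ^ (2:ℝ)) ^ ((1:ℝ)/2)

/-- The weighted Hilbert–Schmidt norm `‖⟨∇⟩^{α₁} γ₀ ⟨∇⟩^{α₂}‖_{𝔖²}`, computed (by Plancherel)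
from `G = γ̂₀`. -/
noncomputable def wHSnorm {d : ℕ} (α₁ α₂ : ℝ) (G : Vd d × Vd d → ℂ) : ℝ≥0∞ :=
  (∫⁻ p : Vd d × Vd d,
      ENNReal.ofReal (jb p.1 ^ (2 * α₁) * jb p.2 ^ (2 * α₂)) * (‖G p‖₊ : ℝ≥0∞) ^ (2:ℝ)) ^ ((1:ℝ)/2)

/-- The density `ρ_{e^{itΔ}γ₀e^{-itΔ}}(x)` of the free evolution, expressed via `G = γ̂₀`
(the Fourier transform of the integral kernel of `γ₀`):
`ρ(t,x) = (2π)^{-2d} ∬ e^{i x·(η+ζ)} e^{-it(|η|²-|ζ|²)} G(η,ζ) dη dζ`. -/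
noncomputable def densFree {d : ℕ} (G : Vd d × Vd d → ℂ) (t : ℝ) (x : Vd d) : ℂ :=
  (((2 * Real.pi) ^ (2 * d))⁻¹ : ℝ) •
    ∫ p : Vd d × Vd d,
      Complex.exp (Complex.I * Complex.ofReal ((⟪x, p.1 + p.2⟫) - t * (‖p.1‖ ^ 2 - ‖p.2‖ ^ 2))) * G p

/-- The `L²_t(S; L^r_x)` norm of a space-time function. -/
noncomputable def l2lr {d : ℕ} (r : ℝ) (S : Set ℝ) (F : ℝ → Vd d → ℂ) : ℝ≥0∞ :=
  (∫⁻ t in S, (∫⁻ x : Vd d, (‖F t x‖₊ : ℝ≥0∞) ^ r) ^ (2 / r)) ^ ((1:ℝ)/2)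


open scoped FourierTransform

/-- The Fourier integral of a function in `L¹ ∩ L²` has the same `L²` norm as the function. -/
theorem eLpNorm_fourier_eq {E : Type*} [NormedAddCommGroup E] [InnerProductSpace ℝ E]
    [FiniteDimensional ℝ E] [MeasurableSpace E] [BorelSpace E] {g : E → ℂ}
    (hg : Integrable g) (hg2 : MemLp g 2) :
    eLpNorm (𝓕 g) 2 volume = eLpNorm g 2 volume := by
  have hcont : Continuous (𝓕 g) :=
    VectorFourier.fourierIntegral_continuous Real.continuous_fourierChar
      (by exact continuous_inner) hg
  set u : Lp ℂ 2 (volume : Measure E) := 𝓕 (hg2.toLp g) with hu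
  have hae : ∀ᵐ x, (u : E → ℂ) x = 𝓕 g x := by
    refine ae_eq_of_integral_contDiff_smul_eq
      (μ := volume)
      ((Lp.memLp u).locallyIntegrable (by norm_num)) hcont.locallyIntegrable fun φ hφ hφc => ?_
    have hφc' : HasCompactSupport (fun x => (φ x : ℂ)) := hφc.comp_left (g := Complex.ofReal) (by simp)
    have hφ' : ContDiff ℝ (⊤ : ℕ∞) (fun x => (φ x : ℂ)) :=
      Complex.ofRealCLM.contDiff.comp hφ
    let ψ : SchwartzMap E ℂ := hφc'.toSchwartzMap hφ'
    have h1 := congrArg (fun T => T ψ) (Lp.fourier_toTemperedDistribution_eq (hg2.toLp g))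
    simp only [TemperedDistribution.fourier_apply, Lp.toTemperedDistribution_apply] at h1
    have h2 : ∫ x, (𝓕 (ψ : E → ℂ)) x • g x = ∫ x, ψ x • 𝓕 g x := by
      have := VectorFourier.integral_fourierIntegral_smul_eq_flip (L := innerₗ E)
        (μ := volume) (ν := volume) Real.continuous_fourierChar
        (by exact continuous_inner) ψ.integrable hg
      rw [flip_innerₗ] at this
      exact this
    have h3 : ∫ x, ψ x • (u : E → ℂ) x = ∫ x, ψ x • 𝓕 g x := by
      rw [← h2, hu, ← h1]
      refine integral_congr_ae ?_
      filter_upwards [hg2.coeFn_toLp] with x hx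
      rw [hx, SchwartzMap.fourier_coe]
    have h4 : ∀ x, ψ x = (φ x : ℂ) := fun x => rfl
    simpa [h4] using h3
  rw [← eLpNorm_congr_ae hae, ← eLpNorm_congr_ae hg2.coeFn_toLp]
  have := Lp.norm_fourier_eq (hg2.toLp g)
  rw [← hu, Lp.norm_def, Lp.norm_def] at this
  exact (ENNReal.toReal_eq_toReal_iff' (Lp.eLpNorm_ne_top _) (Lp.eLpNorm_ne_top _)).1 this

/-- Dilation change of variables for the Lebesgue integral. -/
theorem lintegral_comp_smul_eq {E : Type*} [NormedAddCommGroup E] [InnerProductSpace ℝ E]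
    [FiniteDimensional ℝ E] [MeasurableSpace E] [BorelSpace E] (f : E → ℝ≥0∞) {c : ℝ}
    (hc : c ≠ 0) :
    ∫⁻ x, f (c • x) = ENNReal.ofReal |(c ^ Module.finrank ℝ E)⁻¹| * ∫⁻ x, f x := by
  rw [← smul_eq_mul, ← lintegral_smul_measure, ← Measure.map_addHaar_smul volume hc]
  exact ((Homeomorph.smulOfNeZero c hc).measurableEmbedding.lintegral_map _).symm

/-- Plancherel's inequality for the oscillatory integral with phase `⟪x, ξ⟫`. -/
theorem lintegral_enorm_sq_oscillatory_le {E : Type*} [NormedAddCommGroup E]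
    [InnerProductSpace ℝ E] [FiniteDimensional ℝ E] [MeasurableSpace E] [BorelSpace E]
    {g : E → ℂ} (hg : Integrable g) :
    ∫⁻ x : E, ‖∫ ξ : E, Complex.exp (Complex.I * Complex.ofReal ⟪x, ξ⟫) * g ξ‖ₑ ^ (2 : ℝ) ≤
      ENNReal.ofReal ((2 * Real.pi) ^ Module.finrank ℝ E) * ∫⁻ ξ, ‖g ξ‖ₑ ^ (2 : ℝ) := by
  have hpi : 0 < 2 * Real.pi := by positivity
  by_cases htop : ∫⁻ ξ, ‖g ξ‖ₑ ^ (2 : ℝ) = ⊤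
  · rw [htop, ENNReal.mul_top]
    · exact le_top
    · simp only [ne_eq, ENNReal.ofReal_eq_zero, not_le]
      positivity
  have hg2 : MemLp g 2 := by
    refine ⟨hg.1, ?_⟩
    rw [eLpNorm_lt_top_iff_lintegral_rpow_enorm_lt_top (by norm_num) (by norm_num)]
    simpa using lt_top_iff_ne_top.2 htop
  have key : ∀ x : E, ∫ ξ : E, Complex.exp (Complex.I * Complex.ofReal ⟪x, ξ⟫) * g ξ =
      𝓕 g ((-(2 * Real.pi)⁻¹) • x) := by
    intro x
    rw [Real.fourier_eq']
    refine integral_congr_ae (Eventually.of_forall fun ξ => ?_)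
    simp only [smul_eq_mul]
    congr 2
    rw [inner_smul_right, real_inner_comm]
    push_cast
    field_simp
  simp_rw [key]
  rw [lintegral_comp_smul_eq (fun x => ‖𝓕 g x‖ₑ ^ (2 : ℝ)) (by simp)]
  have h := eLpNorm_fourier_eq hg hg2
  rw [eLpNorm_eq_lintegral_rpow_enorm_toReal (by norm_num) (by norm_num),
    eLpNorm_eq_lintegral_rpow_enorm_toReal (by norm_num) (by norm_num)] at h
  have h' := ENNReal.rpow_left_injective (x := 1 / (2 : ℝ≥0∞).toReal) (by norm_num) h
  simp only [ENNReal.toReal_ofNat] at h'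
  rw [h']
  refine mul_le_mul_left ?_ _
  rw [abs_inv, abs_pow, abs_neg, abs_inv, inv_pow, inv_inv, abs_of_pos hpi]


/-- Weighted Cauchy–Schwarz inequality. -/
theorem lintegral_rpow_two_le_weighted {α : Type*} [MeasurableSpace α] {μ : Measure α}
    {w F : α → ℝ≥0∞} (hw : AEMeasurable w μ) (hF : AEMeasurable F μ)
    (hw0 : ∀ᵐ x ∂μ, w x ≠ 0) (hw1 : ∀ᵐ x ∂μ, w x ≠ ⊤) :
    (∫⁻ x, F x ∂μ) ^ (2 : ℝ) ≤ (∫⁻ x, (w x)⁻¹ ∂μ) * ∫⁻ x, w x * F x ^ (2 : ℝ) ∂μ := by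
  have h1 : ∫⁻ x, F x ∂μ =
      ∫⁻ x, ((fun x => (w x)⁻¹ ^ (1 / 2 : ℝ)) * fun x => w x ^ (1 / 2 : ℝ) * F x) x ∂μ := by
    refine lintegral_congr_ae ?_
    filter_upwards [hw0, hw1] with x h0 h1
    rw [Pi.mul_apply, ← mul_assoc, ← ENNReal.mul_rpow_of_nonneg _ _ (by norm_num),
      ENNReal.inv_mul_cancel h0 h1, ENNReal.one_rpow, one_mul]
  have h2 := ENNReal.lintegral_mul_le_Lp_mul_Lq μ Real.HolderConjugate.two_two
    (f := fun x => (w x)⁻¹ ^ (1 / 2 : ℝ)) (g := fun x => w x ^ (1 / 2 : ℝ) * F x)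
    (hw.inv.pow_const _) ((hw.pow_const _).mul hF)
  rw [← h1] at h2
  refine (ENNReal.rpow_le_rpow h2 (by norm_num : (0 : ℝ) ≤ 2)).trans_eq ?_
  rw [ENNReal.mul_rpow_of_nonneg _ _ (by norm_num), ← ENNReal.rpow_mul, ← ENNReal.rpow_mul]
  norm_num
  congr 1
  · refine lintegral_congr fun x => ?_
    rw [← ENNReal.rpow_two, ← ENNReal.rpow_mul]; norm_num
  · refine lintegral_congr fun x => ?_
    rw [mul_pow, ← ENNReal.rpow_two (w x ^ _), ← ENNReal.rpow_mul]; norm_num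

/-- The weight `‖ξ‖⁻¹` is locally integrable in dimension at least two, with the scaling
bound `R ^ (d - 1)` over balls of radius `R`. -/
theorem exists_lintegral_ball_norm_inv_le {d : ℕ} (hd : 2 ≤ d) :
    ∃ κ : ℝ, 0 < κ ∧ ∀ R : ℝ, 0 < R →
      ∫⁻ ξ : Vd d in Metric.ball 0 R, (ENNReal.ofReal ‖ξ‖)⁻¹ ≤
        ENNReal.ofReal (κ * R ^ ((d : ℝ) - 1)) := by
  have hfin : Module.finrank ℝ (Vd d) = d := by simp
  have : Nontrivial (Vd d) := by
    apply Module.nontrivial_of_finrank_pos (R := ℝ); omega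
  have hne : ∀ᵐ ξ : Vd d, ξ ≠ 0 := by
    simp [ae_iff]
  have hinv : ∀ ξ : Vd d, ξ ≠ 0 → (ENNReal.ofReal ‖ξ‖)⁻¹ = ENNReal.ofReal ‖ξ‖⁻¹ := fun ξ h =>
    (ENNReal.ofReal_inv_of_pos (norm_pos_iff.2 h)).symm
  have hI : IntegrableOn (fun ξ : Vd d => ‖ξ‖⁻¹) (Metric.ball 0 1) := by
    refine integrableOn_ball_of_norm_le_rpow (C := 1) (α := 1) (by omega) ?_ ?_ ?_
    · rw [hfin]; exact_mod_cast hd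
    · refine Eventually.of_forall fun x => ?_
      rw [Real.rpow_neg (norm_nonneg _), Real.rpow_one, one_mul, norm_inv, norm_norm]
    · exact (by fun_prop : Measurable (fun ξ : Vd d => ‖ξ‖⁻¹)).aestronglyMeasurable
  have hK : ∫⁻ ξ : Vd d in Metric.ball 0 1, (ENNReal.ofReal ‖ξ‖)⁻¹ < ⊤ := by
    have := hI.lintegral_lt_top
    refine lt_of_le_of_lt (lintegral_mono_ae ?_) this
    filter_upwards [ae_restrict_of_ae hne] with x hx
    rw [hinv x hx]
  set K := ∫⁻ ξ : Vd d in Metric.ball 0 1, (ENNReal.ofReal ‖ξ‖)⁻¹ with hKdef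
  refine ⟨K.toReal + 1, by positivity, fun R hR => ?_⟩
  have hs := lintegral_comp_smul_eq
    ((Metric.ball (0 : Vd d) R).indicator fun ξ => (ENNReal.ofReal ‖ξ‖)⁻¹) hR.ne'
  have hs' : ∫⁻ ξ : Vd d, (Metric.ball (0 : Vd d) R).indicator
      (fun ξ => (ENNReal.ofReal ‖ξ‖)⁻¹) (R • ξ) = (ENNReal.ofReal R)⁻¹ * K := by
    rw [hKdef, ← lintegral_const_mul _ (by fun_prop),
      ← lintegral_indicator Metric.isOpen_ball.measurableSet]
    refine lintegral_congr fun ξ => ?_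
    have hmem : R • ξ ∈ Metric.ball (0 : Vd d) R ↔ ξ ∈ Metric.ball (0 : Vd d) 1 := by
      simp [norm_smul, abs_of_pos hR, hR]
    by_cases h : ξ ∈ Metric.ball (0 : Vd d) 1
    · rw [Set.indicator_of_mem h, Set.indicator_of_mem (hmem.2 h), norm_smul, Real.norm_eq_abs,
        abs_of_pos hR, ENNReal.ofReal_mul hR.le, ENNReal.mul_inv] <;> simp [hR]
    · rw [Set.indicator_of_notMem h, Set.indicator_of_notMem (fun h' => h (hmem.1 h'))]
  rw [hs', lintegral_indicator Metric.isOpen_ball.measurableSet, hfin,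
    abs_of_pos (by positivity)] at hs
  have hRd : ENNReal.ofReal (R ^ d) * ENNReal.ofReal (R ^ d)⁻¹ = 1 := by
    rw [← ENNReal.ofReal_mul (by positivity), mul_inv_cancel₀ (by positivity), ENNReal.ofReal_one]
  calc ∫⁻ ξ : Vd d in Metric.ball 0 R, (ENNReal.ofReal ‖ξ‖)⁻¹
      = ENNReal.ofReal (R ^ d) * ((ENNReal.ofReal R)⁻¹ * K) := by
        rw [hs, ← mul_assoc, hRd, one_mul]
    _ = ENNReal.ofReal (R ^ ((d : ℝ) - 1)) * K := by
        rw [← mul_assoc, ← ENNReal.ofReal_inv_of_pos hR, ← ENNReal.ofReal_mul (by positivity),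
          Real.rpow_sub hR, Real.rpow_one, Real.rpow_natCast, div_eq_mul_inv]
    _ ≤ ENNReal.ofReal (R ^ ((d : ℝ) - 1)) * ENNReal.ofReal (K.toReal + 1) := by
        refine mul_le_mul_right ?_ _
        rw [ENNReal.le_ofReal_iff_toReal_le hK.ne (by positivity)]
        linarith
    _ = _ := by rw [← ENNReal.ofReal_mul (by positivity), mul_comm]

/-- The primitive of a power on `(0, B]`, as a bound on a lower Lebesgue integral. -/
theorem lintegral_Ioi_indicator_rpow_le {B q : ℝ} (hB : 0 ≤ B) (hq : 0 < q) :
    ∫⁻ s in Set.Ioi (0 : ℝ), (if s ≤ B then ENNReal.ofReal (s ^ (q - 1)) else 0) ≤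
      ENNReal.ofReal (B ^ q / q) := by
  have h1 : ∫⁻ s in Set.Ioi (0 : ℝ), (if s ≤ B then ENNReal.ofReal (s ^ (q - 1)) else 0) =
      ∫⁻ s in Set.Ioc 0 B, ENNReal.ofReal (s ^ (q - 1)) := by
    have : (fun s : ℝ => if s ≤ B then ENNReal.ofReal (s ^ (q - 1)) else 0) =
        (Set.Iic B).indicator fun s => ENNReal.ofReal (s ^ (q - 1)) := by
      ext s; simp [Set.indicator_apply]
    rw [this, lintegral_indicator measurableSet_Iic, Measure.restrict_restrict measurableSet_Iic,
      Set.Iic_inter_Ioi]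
  have h2 : IntervalIntegrable (fun s : ℝ => s ^ (q - 1)) volume 0 B :=
    intervalIntegral.intervalIntegrable_rpow' (by linarith)
  rw [h1, ← ofReal_integral_eq_lintegral_ofReal
    ((intervalIntegrable_iff_integrableOn_Ioc_of_le hB).1 h2),
    ← intervalIntegral.integral_of_le hB, integral_rpow (Or.inl (by linarith))]
  · simp [Real.zero_rpow hq.ne']
  · filter_upwards [self_mem_ae_restrict measurableSet_Ioc] with s hs
    exact Real.rpow_nonneg hs.1.le _


theorem norm_exp_I_mul_ofReal_mul (a : ℝ) (z : ℂ) :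
    ‖Complex.exp (Complex.I * Complex.ofReal a) * z‖ = ‖z‖ := by
  rw [norm_mul, mul_comm Complex.I, Complex.norm_exp_ofReal_mul_I, one_mul]

theorem integrable_oscillatory {α : Type*} [MeasurableSpace α] {μ : Measure α} {g : α → ℂ}
    (hg : Integrable g μ) {a : α → ℝ} (ha : AEMeasurable a μ) :
    Integrable (fun x => Complex.exp (Complex.I * Complex.ofReal (a x)) * g x) μ :=
  hg.mono ((by fun_prop : AEMeasurable (fun x => Complex.exp (Complex.I * Complex.ofReal (a x))) μ).aestronglyMeasurable.mul hg.1)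
    (Eventually.of_forall fun x => (norm_exp_I_mul_ofReal_mul _ _).le)

theorem continuous_oscillatory_integral {d : ℕ} {g : Vd d → ℂ} (hg : Integrable g) :
    Continuous fun x : Vd d =>
      ∫ ξ : Vd d, Complex.exp (Complex.I * Complex.ofReal ⟪x, ξ⟫) * g ξ := by
  refine continuous_of_dominated (bound := fun ξ => ‖g ξ‖)
    (fun x => (integrable_oscillatory hg (by fun_prop)).1)
    (fun x => Eventually.of_forall fun ξ => (norm_exp_I_mul_ofReal_mul _ _).le) hg.norm
    (Eventually.of_forall fun ξ => by fun_prop)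

/-- Distribution function bound for an oscillatory integral in terms of the high frequencies. -/
theorem meas_lt_oscillatory_le {d : ℕ} {κ : ℝ}
    (hκ : 0 < κ) (hball : ∀ R : ℝ, 0 < R →
      ∫⁻ ξ : Vd d in Metric.ball 0 R, (ENNReal.ofReal ‖ξ‖)⁻¹ ≤
        ENNReal.ofReal (κ * R ^ ((d : ℝ) - 1))) (hd : 2 ≤ d)
    {g : Vd d → ℂ} (hg : Integrable g) {N : ℝ} (hN : 0 < N)
    (hgN : ∫⁻ ξ, ENNReal.ofReal ‖ξ‖ * ‖g ξ‖ₑ ^ (2 : ℝ) ≤ ENNReal.ofReal N)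
    {s : ℝ} (hs : 0 < s) :
    volume {x : Vd d | s < ‖∫ ξ : Vd d, Complex.exp (Complex.I * Complex.ofReal ⟪x, ξ⟫) * g ξ‖} ≤
      ENNReal.ofReal ((2 * Real.pi) ^ d * 4) * ENNReal.ofReal (s ^ (-2 : ℝ)) *
        ∫⁻ ξ, if s ≤ (4 * κ * N) ^ (1 / 2 : ℝ) * ‖ξ‖ ^ (((d : ℝ) - 1) / 2) then
          ‖g ξ‖ₑ ^ (2 : ℝ) else 0 := by
  have hd' : (2 : ℝ) ≤ d := by exact_mod_cast hd
  set a : ℝ := ((d : ℝ) - 1) / 2 with ha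
  have ha0 : 0 < a := by rw [ha]; linarith
  set M : ℝ := (4 * κ * N) ^ (1 / 2 : ℝ) with hM
  have hM0 : 0 < M := by positivity
  have hM2 : M ^ 2 = 4 * κ * N := by
    rw [hM, ← Real.rpow_natCast, ← Real.rpow_mul (by positivity)]; norm_num
  set R : ℝ := (s / M) ^ a⁻¹ with hR
  have hR0 : 0 < R := by positivity
  have hRd : R ^ ((d : ℝ) - 1) = (s / M) ^ 2 := by
    rw [hR, ← Real.rpow_mul (by positivity), ← Real.rpow_natCast]
    congr 1
    have : (d : ℝ) - 1 ≠ 0 := by linarith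
    rw [ha]; field_simp; norm_num
  have hRa : R ^ a = s / M := by
    rw [hR, Real.rpow_inv_rpow (by positivity) ha0.ne']
  have hmem : ∀ ξ : Vd d, ξ ∉ Metric.ball (0 : Vd d) R → s ≤ M * ‖ξ‖ ^ a := by
    intro ξ h
    have h' : R ≤ ‖ξ‖ := by simpa using h
    have := Real.rpow_le_rpow hR0.le h' ha0.le
    rw [hRa, div_le_iff₀ hM0] at this
    linarith
  have hmb : MeasurableSet (Metric.ball (0 : Vd d) R) := Metric.isOpen_ball.measurableSet
  set gl := (Metric.ball (0 : Vd d) R).indicator g with hgl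
  set gh := (Metric.ball (0 : Vd d) R)ᶜ.indicator g with hgh
  have hgli : Integrable gl := hg.indicator hmb
  have hghi : Integrable gh := hg.indicator hmb.compl
  have hnt : Nontrivial (Vd d) := by
    apply Module.nontrivial_of_finrank_pos (R := ℝ); simp; omega
  have hlow : ∫⁻ ξ, ‖gl ξ‖ₑ ≤ ENNReal.ofReal (s / 2) := by
    have h1 : ∫⁻ ξ, ‖gl ξ‖ₑ = ∫⁻ ξ in Metric.ball (0 : Vd d) R, ‖g ξ‖ₑ := by
      rw [← lintegral_indicator hmb]
      refine lintegral_congr fun ξ => ?_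
      rw [hgl, enorm_indicator_eq_indicator_enorm]
    have h2 := lintegral_rpow_two_le_weighted (μ := volume.restrict (Metric.ball (0 : Vd d) R))
      (w := fun ξ => ENNReal.ofReal ‖ξ‖) (F := fun ξ => ‖g ξ‖ₑ)
      (by fun_prop) hg.1.enorm.restrict
      (ae_restrict_of_ae (by
        have : ∀ᵐ ξ : Vd d, ξ ≠ 0 := by simp [ae_iff]
        filter_upwards [this] with ξ hξ
        simpa using hξ))
      (Eventually.of_forall fun _ => ENNReal.ofReal_ne_top)
    rw [h1, ← ENNReal.rpow_le_rpow_iff (z := 2) (by norm_num)]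
    refine h2.trans ((mul_le_mul' (hball R hR0) ((setLIntegral_le_lintegral _ _).trans hgN)).trans ?_)
    rw [ENNReal.ofReal_rpow_of_nonneg (by positivity) (by norm_num),
      ← ENNReal.ofReal_mul (by positivity), hRd]
    refine ENNReal.ofReal_le_ofReal (le_of_eq ?_)
    rw [Real.rpow_two, div_pow, hM2]
    field_simp
    norm_num
  have hsub : {x : Vd d | s <
      ‖∫ ξ : Vd d, Complex.exp (Complex.I * Complex.ofReal ⟪x, ξ⟫) * g ξ‖} ⊆
      {x : Vd d | ENNReal.ofReal (s / 2) ^ (2 : ℝ) ≤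
        ‖∫ ξ : Vd d, Complex.exp (Complex.I * Complex.ofReal ⟪x, ξ⟫) * gh ξ‖ₑ ^ (2 : ℝ)} := by
    intro x hx
    simp only [Set.mem_ofPred_eq] at hx ⊢
    have hsplit : ∫ ξ : Vd d, Complex.exp (Complex.I * Complex.ofReal ⟪x, ξ⟫) * g ξ =
        (∫ ξ : Vd d, Complex.exp (Complex.I * Complex.ofReal ⟪x, ξ⟫) * gl ξ) +
        ∫ ξ : Vd d, Complex.exp (Complex.I * Complex.ofReal ⟪x, ξ⟫) * gh ξ := by
      rw [← integral_add (integrable_oscillatory hgli (by fun_prop))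
        (integrable_oscillatory hghi (by fun_prop))]
      refine integral_congr_ae (Eventually.of_forall fun ξ => ?_)
      simp only [← mul_add]
      rw [hgl, hgh, ← Pi.add_apply, Set.indicator_self_add_compl]
    have hl : ‖∫ ξ : Vd d, Complex.exp (Complex.I * Complex.ofReal ⟪x, ξ⟫) * gl ξ‖ ≤ s / 2 := by
      rw [← ENNReal.ofReal_le_ofReal_iff (by positivity), ofReal_norm]
      refine (enorm_integral_le_lintegral_enorm _).trans (le_trans (le_of_eq ?_) hlow)
      refine lintegral_congr fun ξ => ?_
      rw [← ofReal_norm, norm_exp_I_mul_ofReal_mul, ofReal_norm]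
    rw [hsplit] at hx
    have hh := hx.trans_le (norm_add_le _ _)
    refine ENNReal.rpow_le_rpow ?_ (by norm_num)
    rw [← ofReal_norm]
    exact ENNReal.ofReal_le_ofReal (by linarith)
  refine (measure_mono hsub).trans ((meas_ge_le_lintegral_div ?_ ?_ ?_).trans ?_)
  · exact ((continuous_oscillatory_integral hghi).enorm.measurable.pow_const _).aemeasurable
  · simp [hs]
  · simp
  rw [div_eq_mul_inv, ENNReal.ofReal_rpow_of_pos (by positivity),
    ← ENNReal.ofReal_inv_of_pos (by positivity)]
  have hplan := lintegral_enorm_sq_oscillatory_le hghi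
  have hfin : Module.finrank ℝ (Vd d) = d := by simp
  rw [hfin] at hplan
  refine (mul_le_mul_left hplan _).trans ?_
  rw [mul_right_comm]
  refine mul_le_mul' (le_of_eq ?_) (lintegral_mono fun ξ => ?_)
  · rw [← ENNReal.ofReal_mul (by positivity), ← ENNReal.ofReal_mul (by positivity)]
    congr 1
    rw [Real.rpow_neg hs.le, Real.rpow_two, Real.rpow_two]
    field_simp
    norm_num
  · by_cases h : ξ ∈ Metric.ball (0 : Vd d) R
    · rw [hgh, Set.indicator_of_notMem (by simpa using h)]
      simp
    · rw [hgh, Set.indicator_of_mem (by simpa using h), if_pos (hmem ξ h)]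

/-- The Sobolev inequality `Ḣ^{1/2} ⊂ L^{2d/(d-1)}` on the Fourier side. -/
theorem exists_sobolev_half_const {d : ℕ} (hd : 2 ≤ d) :
    ∃ C : ℝ, 0 < C ∧ ∀ g : Vd d → ℂ, Measurable g → Integrable g →
      (∫⁻ x : Vd d, ‖∫ ξ : Vd d, Complex.exp (Complex.I * Complex.ofReal ⟪x, ξ⟫) * g ξ‖ₑ ^
        (2 * d / ((d : ℝ) - 1))) ^ (2 / (2 * d / ((d : ℝ) - 1))) ≤
      ENNReal.ofReal C * ∫⁻ ξ, ENNReal.ofReal ‖ξ‖ * ‖g ξ‖ₑ ^ (2 : ℝ) := by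
  obtain ⟨κ, hκ, hball⟩ := exists_lintegral_ball_norm_inv_le hd
  have hd' : (2 : ℝ) ≤ d := by exact_mod_cast hd
  set p : ℝ := 2 * d / ((d : ℝ) - 1) with hp
  have hp2 : 0 < p - 2 := by
    rw [hp, sub_pos, lt_div_iff₀ (by linarith)]; linarith
  have hap : ((d : ℝ) - 1) / 2 * (p - 2) = 1 := by
    have : (d : ℝ) - 1 ≠ 0 := by linarith
    rw [hp]; field_simp; ring
  set D : ℝ := p * ((2 * Real.pi) ^ d * 4) * ((4 * κ) ^ ((p - 2) / 2) / (p - 2)) with hD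
  have hD0 : 0 < D := by
    have : 0 < p := by linarith
    positivity
  refine ⟨D ^ (2 / p), by positivity, fun g hgm hg => ?_⟩
  set I := ∫⁻ ξ, ENNReal.ofReal ‖ξ‖ * ‖g ξ‖ₑ ^ (2 : ℝ) with hI
  by_cases hItop : I = ⊤
  · rw [hItop, ENNReal.mul_top]
    · exact le_top
    · simp only [ne_eq, ENNReal.ofReal_eq_zero, not_le]; positivity
  have hnt : Nontrivial (Vd d) := by
    apply Module.nontrivial_of_finrank_pos (R := ℝ); simp; omega
  by_cases hI0 : I = 0
  · have h1 : ∀ᵐ ξ, g ξ = 0 := by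
      rw [hI, lintegral_eq_zero_iff (by fun_prop)] at hI0
      have h0 : ∀ᵐ ξ : Vd d, ξ ≠ 0 := by simp [ae_iff]
      filter_upwards [hI0, h0] with ξ h h'
      simpa [h'] using h
    have h2 : ∀ x : Vd d,
        ∫ ξ : Vd d, Complex.exp (Complex.I * Complex.ofReal ⟪x, ξ⟫) * g ξ = 0 := by
      intro x
      refine integral_eq_zero_of_ae ?_
      filter_upwards [h1] with ξ hξ
      simp [hξ]
    simp_rw [h2]
    have hp0 : 0 < p := by linarith
    simp [hp0]
  set N : ℝ := I.toReal with hNdef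
  have hN : 0 < N := ENNReal.toReal_pos hI0 hItop
  have hIN : I = ENNReal.ofReal N := (ENNReal.ofReal_toReal hItop).symm
  have hp0 : 0 < p := by linarith
  set f : Vd d → ℂ := fun x =>
    ∫ ξ : Vd d, Complex.exp (Complex.I * Complex.ofReal ⟪x, ξ⟫) * g ξ with hf
  have hfc : Continuous f := continuous_oscillatory_integral hg
  set M : ℝ := (4 * κ * N) ^ (1 / 2 : ℝ) with hM
  have hM0 : 0 < M := by positivity
  have hmain : ∫⁻ x, ‖f x‖ₑ ^ p ≤ ENNReal.ofReal (D * N ^ (p / 2)) := by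
    have hlc := lintegral_rpow_eq_lintegral_meas_lt_mul (μ := (volume : Measure (Vd d)))
      (f := fun x => ‖f x‖) (Eventually.of_forall fun x => norm_nonneg _)
      hfc.norm.measurable.aemeasurable hp0
    calc ∫⁻ x, ‖f x‖ₑ ^ p = ∫⁻ x, ENNReal.ofReal (‖f x‖ ^ p) := by
          refine lintegral_congr fun x => ?_
          rw [← ofReal_norm, ENNReal.ofReal_rpow_of_nonneg (norm_nonneg _) hp0.le]
      _ = _ := hlc
      _ ≤ ENNReal.ofReal p * ∫⁻ s in Set.Ioi (0 : ℝ), ENNReal.ofReal ((2 * Real.pi) ^ d * 4) *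
            ∫⁻ ξ, ‖g ξ‖ₑ ^ (2 : ℝ) * (if s ≤ M * ‖ξ‖ ^ (((d : ℝ) - 1) / 2) then
              ENNReal.ofReal (s ^ (p - 2 - 1)) else 0) := by
          refine mul_le_mul_right (setLIntegral_mono' measurableSet_Ioi fun s hs => ?_) _
          have hs' : 0 < s := hs
          refine (mul_le_mul_left (meas_lt_oscillatory_le hκ hball hd hg hN hIN.le hs') _).trans ?_
          rw [mul_assoc, mul_assoc]
          refine mul_le_mul_right ?_ _
          rw [mul_left_comm, mul_comm, mul_assoc, ← mul_assoc, ← ENNReal.ofReal_mul (by positivity),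
            ← Real.rpow_add hs', show -2 + (p - 1) = p - 2 - 1 by ring, ← lintegral_const_mul']
          · refine lintegral_mono fun ξ => ?_
            split_ifs
            · rw [mul_comm]
            · simp
          · exact ENNReal.ofReal_ne_top
      _ = ENNReal.ofReal p * (ENNReal.ofReal ((2 * Real.pi) ^ d * 4) *
            ∫⁻ ξ, ‖g ξ‖ₑ ^ (2 : ℝ) * ∫⁻ s in Set.Ioi (0 : ℝ),
              (if s ≤ M * ‖ξ‖ ^ (((d : ℝ) - 1) / 2) then
                ENNReal.ofReal (s ^ (p - 2 - 1)) else 0)) := by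
          have hmeas : Measurable fun z : ℝ × Vd d => ‖g z.2‖ₑ ^ (2 : ℝ) *
              (if z.1 ≤ M * ‖z.2‖ ^ (((d : ℝ) - 1) / 2) then
                ENNReal.ofReal (z.1 ^ (p - 2 - 1)) else 0) := by
            refine Measurable.mul (by fun_prop) (Measurable.ite ?_ (by fun_prop) measurable_const)
            exact measurableSet_le (by fun_prop) (by fun_prop)
          rw [lintegral_const_mul' _ _ ENNReal.ofReal_ne_top,
            lintegral_lintegral_swap hmeas.aemeasurable]
          congr 2
          refine lintegral_congr fun ξ => ?_
          rw [lintegral_const_mul']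
          exact ENNReal.rpow_ne_top_of_nonneg (by norm_num) enorm_ne_top
      _ ≤ ENNReal.ofReal p * (ENNReal.ofReal ((2 * Real.pi) ^ d * 4) *
            ∫⁻ ξ, ENNReal.ofReal (M ^ (p - 2) / (p - 2)) *
              (ENNReal.ofReal ‖ξ‖ * ‖g ξ‖ₑ ^ (2 : ℝ))) := by
          refine mul_le_mul_right (mul_le_mul_right (lintegral_mono fun ξ => ?_) _) _
          refine (mul_le_mul_right (lintegral_Ioi_indicator_rpow_le (by positivity) hp2) _).trans
            (le_of_eq ?_)
          rw [Real.mul_rpow hM0.le (by positivity), ← Real.rpow_mul (norm_nonneg _), hap,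
            Real.rpow_one, mul_comm, ← mul_assoc, ← ENNReal.ofReal_mul (by positivity)]
          congr 2
          ring
      _ = ENNReal.ofReal (D * N ^ (p / 2)) := by
          rw [lintegral_const_mul' _ _ ENNReal.ofReal_ne_top, ← hI, hIN,
            ← ENNReal.ofReal_mul (by positivity), ← ENNReal.ofReal_mul (by positivity),
            ← ENNReal.ofReal_mul (by positivity)]
          congr 1
          have h1 : M ^ (p - 2) = (4 * κ) ^ ((p - 2) / 2) * N ^ ((p - 2) / 2) := by
            rw [hM, ← Real.rpow_mul (by positivity), ← Real.mul_rpow (by positivity) hN.le]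
            congr 1; ring
          have h2 : N ^ (p / 2) = N ^ ((p - 2) / 2) * N := by
            rw [← Real.rpow_add_one hN.ne']; congr 1; ring
          rw [h1, h2, hD]; ring
  refine (ENNReal.rpow_le_rpow hmain (by positivity)).trans (le_of_eq ?_)
  rw [ENNReal.ofReal_rpow_of_nonneg (by positivity) (by positivity), hIN,
    ← ENNReal.ofReal_mul (by positivity), Real.mul_rpow hD0.le (by positivity),
    ← Real.rpow_mul hN.le, show p / 2 * (2 / p) = 1 by field_simp, Real.rpow_one]


/-- Measure-preserving coordinates adapted to the splitting of `ℝ^{n+1}` into the line spanned by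
a unit vector and its orthogonal hyperplane. -/
theorem exists_measurableEquiv_hyperplane {n : ℕ} {ω : Vd (n + 1)} (hω : ‖ω‖ = 1) :
    ∃ e : ℝ × (Fin n → ℝ) ≃ᵐ Vd (n + 1), MeasurePreserving e volume volume ∧
      ∀ z, ⟪e z, ω⟫ = z.1 ∧ ‖e z‖ ^ 2 = z.1 ^ 2 + ∑ i, z.2 i ^ 2 := by
  obtain ⟨b, hb⟩ := Orthonormal.exists_orthonormalBasis_extension_of_card_eq
    (𝕜 := ℝ) (E := Vd (n + 1)) (ι := Fin (n + 1)) (by simp) (v := fun _ => ω) (s := {0})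
    ⟨fun i => by simpa using hω, fun i j hij => (hij (Subsingleton.elim i j)).elim⟩
  have hb0 : b 0 = ω := hb 0 rfl
  let e₁ := (MeasurableEquiv.piFinSuccAbove (fun _ : Fin (n + 1) => ℝ) 0).symm
  let e₂ := MeasurableEquiv.toLp 2 (Fin (n + 1) → ℝ)
  let e₃ := b.measurableEquiv.symm
  refine ⟨(e₁.trans e₂).trans e₃, ?_, fun z => ?_⟩
  · exact (b.measurePreserving_measurableEquiv.symm _).comp
      ((PiLp.volume_preserving_toLp (Fin (n + 1))).comp
        ((volume_preserving_piFinSuccAbove (fun _ : Fin (n + 1) => ℝ) 0).symm _))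
  · have he : ((e₁.trans e₂).trans e₃) z = b.repr.symm (WithLp.toLp 2 (Fin.cons z.1 z.2)) := by
      simp [e₁, e₂, e₃, OrthonormalBasis.measurableEquiv, MeasurableEquiv.piFinSuccAbove]
      rfl
    rw [he]
    constructor
    · rw [← hb0, real_inner_comm, ← b.repr_apply_apply]
      simp
    · rw [LinearIsometryEquiv.norm_map, EuclideanSpace.norm_sq_eq, Fin.sum_univ_succ]
      simp

theorem one_add_norm_sq_rpow_le_jb {d : ℕ} {η : Vd d} {b α : ℝ} (hα : 0 ≤ α)
    (hb : b ^ 2 ≤ ‖η‖ ^ 2) : (1 + b ^ 2) ^ α ≤ jb η ^ (2 * α) := by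
  rw [jb, ← Real.rpow_mul (by positivity)]
  rw [show (1 : ℝ) / 2 * (2 * α) = α by ring]
  exact Real.rpow_le_rpow (by positivity) (by linarith) hα

theorem jb_pos {d : ℕ} (η : Vd d) : 0 < jb η := by
  unfold jb; positivity

theorem measurable_jb {d : ℕ} : Measurable (jb : Vd d → ℝ) := by
  unfold jb; fun_prop

theorem norm_sq_le_sum_sq {n : ℕ} (y : Fin n → ℝ) : ‖y‖ ^ 2 ≤ ∑ i, y i ^ 2 := by
  have h0 : 0 ≤ ∑ i, y i ^ 2 := Finset.sum_nonneg fun i _ => sq_nonneg _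
  have : ‖y‖ ≤ √(∑ i, y i ^ 2) := by
    rw [pi_norm_le_iff_of_nonneg (Real.sqrt_nonneg _)]
    intro i
    rw [Real.norm_eq_abs]
    refine Real.abs_le_sqrt ?_
    exact Finset.single_le_sum (f := fun i => y i ^ 2) (fun i _ => sq_nonneg _) (Finset.mem_univ i)
  calc ‖y‖ ^ 2 ≤ (√(∑ i, y i ^ 2)) ^ 2 := by gcongr
    _ = _ := Real.sq_sqrt h0

/-- For a fixed output frequency `ξ`, Plancherel in time and Cauchy–Schwarz on the hyperplanes
orthogonal to `ξ` bound the time norm of the Fourier transform of the density. -/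
theorem exists_time_plancherel_const {n : ℕ} {α₁ α₂ : ℝ} (h₁ : 0 ≤ α₁) (h₂ : 0 ≤ α₂)
    (hsum : (n : ℝ) / 2 < α₁ + α₂) :
    ∃ K : ℝ, 0 ≤ K ∧ ∀ ξ : Vd (n + 1), ξ ≠ 0 → ∀ H : Vd (n + 1) → ℂ, Measurable H →
      Integrable H →
      ENNReal.ofReal ‖ξ‖ * ∫⁻ t : ℝ, ‖∫ η : Vd (n + 1),
        Complex.exp (-(Complex.I * Complex.ofReal (t * (‖η‖ ^ 2 - ‖ξ - η‖ ^ 2)))) * H η‖ₑ ^ (2 : ℝ) ≤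
      ENNReal.ofReal K * ∫⁻ η : Vd (n + 1),
        ENNReal.ofReal (jb η ^ (2 * α₂) * jb (ξ - η) ^ (2 * α₁)) * ‖H η‖ₑ ^ (2 : ℝ) := by
  have hint : Integrable (fun y : Fin n → ℝ => (1 + ‖y‖ ^ 2) ^ (-(2 * (α₁ + α₂)) / 2)) :=
    integrable_rpow_neg_one_add_norm_sq (by simp; linarith)
  set K₀ : ℝ := ∫ y : Fin n → ℝ, (1 + ‖y‖ ^ 2) ^ (-(2 * (α₁ + α₂)) / 2) with hK₀
  have hK₀0 : 0 ≤ K₀ := integral_nonneg fun y => by positivity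
  refine ⟨Real.pi * K₀, by positivity, fun ξ hξ H hHm hH => ?_⟩
  set r := ‖ξ‖ with hr
  have hr0 : 0 < r := norm_pos_iff.2 hξ
  obtain ⟨e, he, hez⟩ := exists_measurableEquiv_hyperplane (ω := r⁻¹ • ξ)
    (by rw [norm_smul, norm_inv, norm_norm]; exact inv_mul_cancel₀ hr0.ne')
  have hinner : ∀ z, ⟪e z, ξ⟫ = r * z.1 := fun z => by
    rw [← (hez z).1, inner_smul_right, ← mul_assoc, mul_inv_cancel₀ hr0.ne', one_mul]
  have hdiff : ∀ z, ‖ξ - e z‖ ^ 2 = (r - z.1) ^ 2 + ∑ i, z.2 i ^ 2 := fun z => by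
    rw [norm_sub_sq_real, real_inner_comm, hinner, (hez z).2]; ring
  have hHe : Integrable (fun z => H (e z)) (volume.prod volume) :=
    he.integrable_comp_of_integrable hH
  set w : Vd (n + 1) → ℝ≥0∞ :=
    fun η => ENNReal.ofReal (jb η ^ (2 * α₂) * jb (ξ - η) ^ (2 * α₁)) with hw
  have hwm : Measurable w := by
    have := measurable_jb (d := n + 1)
    rw [hw]; fun_prop
  have hw0 : ∀ η, 0 < jb η ^ (2 * α₂) * jb (ξ - η) ^ (2 * α₁) := fun η =>
    mul_pos (Real.rpow_pos_of_pos (jb_pos _) _) (Real.rpow_pos_of_pos (jb_pos _) _)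
  have hwinv : ∀ s : ℝ, ∫⁻ y : Fin n → ℝ, (w (e (s, y)))⁻¹ ≤ ENNReal.ofReal K₀ := by
    intro s
    rw [hK₀, ofReal_integral_eq_lintegral_ofReal hint
      (Eventually.of_forall fun y => by positivity)]
    refine lintegral_mono fun y => ?_
    rw [hw, ← ENNReal.ofReal_inv_of_pos (hw0 _)]
    refine ENNReal.ofReal_le_ofReal ?_
    rw [show -(2 * (α₁ + α₂)) / 2 = -(α₂ + α₁) by ring, Real.rpow_neg (by positivity)]
    refine inv_anti₀ (by positivity) ?_
    rw [Real.rpow_add (by positivity)]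
    have hy := norm_sq_le_sum_sq y
    refine mul_le_mul (one_add_norm_sq_rpow_le_jb h₂ ?_) (one_add_norm_sq_rpow_le_jb h₁ ?_)
      (by positivity) (Real.rpow_nonneg (jb_pos _).le _)
    · rw [(hez _).2]; nlinarith [sq_nonneg s]
    · rw [hdiff]; nlinarith [sq_nonneg (r - s)]
  set h : ℝ → ℂ := fun s => ∫ y : Fin n → ℝ, H (e (s, y)) with hh
  have hhi : Integrable h := hHe.integral_prod_left
  have hhle : ∀ s, ‖h s‖ₑ ^ (2 : ℝ) ≤ ENNReal.ofReal K₀ *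
      ∫⁻ y : Fin n → ℝ, w (e (s, y)) * ‖H (e (s, y))‖ₑ ^ (2 : ℝ) := by
    intro s
    refine (ENNReal.rpow_le_rpow (enorm_integral_le_lintegral_enorm _) (by norm_num)).trans ?_
    refine (lintegral_rpow_two_le_weighted (w := fun y => w (e (s, y))) ?_ ?_ ?_ ?_).trans
      (mul_le_mul_left (hwinv s) _)
    · exact (hwm.comp (e.measurable.comp measurable_prodMk_left)).aemeasurable
    · exact (hHm.comp (e.measurable.comp measurable_prodMk_left)).enorm.aemeasurable
    · exact Eventually.of_forall fun y => by simpa [hw] using hw0 _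
    · exact Eventually.of_forall fun y => ENNReal.ofReal_ne_top
  have hosc : ∀ t : ℝ, ‖∫ η : Vd (n + 1),
      Complex.exp (-(Complex.I * Complex.ofReal (t * (‖η‖ ^ 2 - ‖ξ - η‖ ^ 2)))) * H η‖ₑ =
      ‖∫ s : ℝ, Complex.exp (Complex.I * Complex.ofReal ⟪(-2 * r) • t, s⟫) * h s‖ₑ := by
    intro t
    have h1 : ∫ η : Vd (n + 1),
        Complex.exp (-(Complex.I * Complex.ofReal (t * (‖η‖ ^ 2 - ‖ξ - η‖ ^ 2)))) * H η =
        Complex.exp (Complex.I * Complex.ofReal (t * r ^ 2)) *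
        ∫ s : ℝ, Complex.exp (Complex.I * Complex.ofReal ⟪(-2 * r) • t, s⟫) * h s := by
      rw [← he.integral_comp e.measurableEmbedding]
      have h2 : ∀ z : ℝ × (Fin n → ℝ),
          Complex.exp (-(Complex.I * Complex.ofReal (t * (‖e z‖ ^ 2 - ‖ξ - e z‖ ^ 2)))) * H (e z) =
          Complex.exp (Complex.I * Complex.ofReal (t * r ^ 2)) *
          (Complex.exp (Complex.I * Complex.ofReal ⟪(-2 * r) • t, z.1⟫) * H (e z)) := by
        intro z
        rw [← mul_assoc, ← Complex.exp_add, (hez z).2, hdiff]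
        congr 2
        simp
        ring
      simp_rw [h2]
      rw [integral_const_mul]
      congr 1
      rw [Measure.volume_eq_prod, integral_prod _ (integrable_oscillatory hHe (by fun_prop))]
      refine integral_congr_ae (Eventually.of_forall fun s => ?_)
      simp only [hh, integral_const_mul]
    rw [h1, ← ofReal_norm, norm_exp_I_mul_ofReal_mul, ofReal_norm]
  simp_rw [hosc]
  rw [lintegral_comp_smul_eq (fun x : ℝ =>
    ‖∫ s : ℝ, Complex.exp (Complex.I * Complex.ofReal ⟪x, s⟫) * h s‖ₑ ^ (2 : ℝ))
    (by simpa using hr0.ne')]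
  have hplan := lintegral_enorm_sq_oscillatory_le hhi
  simp only [Module.finrank_self, pow_one] at hplan ⊢
  have hfinal : ∫⁻ s, ‖h s‖ₑ ^ (2 : ℝ) ≤
      ENNReal.ofReal K₀ * ∫⁻ η, w η * ‖H η‖ₑ ^ (2 : ℝ) := by
    refine (lintegral_mono hhle).trans (le_of_eq ?_)
    rw [lintegral_const_mul' _ _ ENNReal.ofReal_ne_top,
      ← he.lintegral_comp_emb e.measurableEmbedding, Measure.volume_eq_prod, lintegral_prod]
    exact ((hwm.comp e.measurable).mul
      ((hHm.comp e.measurable).enorm.pow_const _)).aemeasurable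
  refine (mul_le_mul_right (mul_le_mul_right
    (hplan.trans (mul_le_mul_right hfinal _)) _) _).trans (le_of_eq ?_)
  rw [← mul_assoc, ← mul_assoc, ← mul_assoc, ← ENNReal.ofReal_mul hr0.le,
    ← ENNReal.ofReal_mul (by positivity), ← ENNReal.ofReal_mul (by positivity)]
  congr 2
  rw [abs_inv, abs_mul, abs_of_pos hr0, abs_neg, abs_two]
  field_simp


/-- The change of variables `(ξ, η) ↦ (η, ξ - η)` preserves Lebesgue measure. -/
theorem exists_measurableEquiv_shear (d : ℕ) :
    ∃ e : Vd d × Vd d ≃ᵐ Vd d × Vd d, MeasurePreserving e volume volume ∧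
      ∀ z, e z = (z.2, z.1 - z.2) := by
  refine ⟨MeasurableEquiv.prodComm.trans (MeasurableEquiv.shearAddRight (Vd d)).symm,
    (measurePreserving_prod_neg_add (volume : Measure (Vd d)) volume).comp
      Measure.measurePreserving_swap, fun z => ?_⟩
  change (z.2, -z.2 + z.1) = _
  rw [neg_add_eq_sub]

/-- The density of the free evolution as an oscillatory integral over the output frequency. -/
theorem densFree_eq_oscillatory {d : ℕ} {G : Vd d × Vd d → ℂ} (hG : Integrable G) (t : ℝ)
    (x : Vd d) :
    densFree G t x = (((2 * Real.pi) ^ (2 * d))⁻¹ : ℝ) •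
      ∫ ξ : Vd d, Complex.exp (Complex.I * Complex.ofReal ⟪x, ξ⟫) *
        ∫ η : Vd d, Complex.exp (-(Complex.I * Complex.ofReal (t * (‖η‖ ^ 2 - ‖ξ - η‖ ^ 2)))) *
          G (η, ξ - η) := by
  obtain ⟨e, he, hez⟩ := exists_measurableEquiv_shear d
  have hGe : Integrable (fun z => G (e z)) (volume.prod volume) :=
    he.integrable_comp_of_integrable hG
  unfold densFree
  congr 1
  rw [← he.integral_comp e.measurableEmbedding, Measure.volume_eq_prod,
    integral_prod _ (integrable_oscillatory hGe (by simp_rw [hez]; fun_prop))]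
  refine integral_congr_ae (Eventually.of_forall fun ξ => ?_)
  simp only [← integral_const_mul]
  refine integral_congr_ae (Eventually.of_forall fun η => ?_)
  simp only [hez]
  rw [← mul_assoc, ← Complex.exp_add, add_sub_cancel]
  congr 2
  push_cast
  ring

/-- The half-derivative of the density is controlled in `L²` of space-time. -/
theorem lintegral_half_derivative_le {n : ℕ} {K α₁ α₂ : ℝ}
    (htime : ∀ ξ : Vd (n + 1), ξ ≠ 0 → ∀ H : Vd (n + 1) → ℂ, Measurable H →
      Integrable H →
      ENNReal.ofReal ‖ξ‖ * ∫⁻ t : ℝ, ‖∫ η : Vd (n + 1),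
        Complex.exp (-(Complex.I * Complex.ofReal (t * (‖η‖ ^ 2 - ‖ξ - η‖ ^ 2)))) * H η‖ₑ ^ (2 : ℝ) ≤
      ENNReal.ofReal K * ∫⁻ η : Vd (n + 1),
        ENNReal.ofReal (jb η ^ (2 * α₂) * jb (ξ - η) ^ (2 * α₁)) * ‖H η‖ₑ ^ (2 : ℝ))
    {G : Vd (n + 1) × Vd (n + 1) → ℂ} (hGm : Measurable G) (hG : Integrable G)
    {g : ℝ → Vd (n + 1) → ℂ} (hgm : Measurable (Function.uncurry g))
    (hg : ∀ t ξ, g t ξ = ∫ η : Vd (n + 1),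
      Complex.exp (-(Complex.I * Complex.ofReal (t * (‖η‖ ^ 2 - ‖ξ - η‖ ^ 2)))) * G (η, ξ - η)) :
    ∫⁻ t, ∫⁻ ξ, ENNReal.ofReal ‖ξ‖ * ‖g t ξ‖ₑ ^ (2 : ℝ) ≤
      ENNReal.ofReal K * ∫⁻ p : Vd (n + 1) × Vd (n + 1),
        ENNReal.ofReal (jb p.1 ^ (2 * α₂) * jb p.2 ^ (2 * α₁)) * ‖G p‖ₑ ^ (2 : ℝ) := by
  obtain ⟨e, he, hez⟩ := exists_measurableEquiv_shear (n + 1)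
  have hGe : Integrable (fun z => G (e z)) (volume.prod volume) :=
    he.integrable_comp_of_integrable hG
  have hjb := measurable_jb (d := n + 1)
  have hm : Measurable fun z : ℝ × Vd (n + 1) =>
      ENNReal.ofReal ‖z.2‖ * ‖g z.1 z.2‖ₑ ^ (2 : ℝ) :=
    Measurable.mul (by fun_prop) (hgm.enorm.pow_const _)
  rw [lintegral_lintegral_swap hm.aemeasurable, ← he.lintegral_comp_emb e.measurableEmbedding,
    Measure.volume_eq_prod, lintegral_prod, ← lintegral_const_mul' _ _ ENNReal.ofReal_ne_top]
  · refine lintegral_mono_ae ?_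
    have hne : ∀ᵐ ξ : Vd (n + 1), ξ ≠ 0 := by
      have : Nontrivial (Vd (n + 1)) := by
        apply Module.nontrivial_of_finrank_pos (R := ℝ); simp
      simp [ae_iff]
    filter_upwards [hne, hGe.prod_right_ae] with ξ hξ hGξ
    simp only [hez] at hGξ ⊢
    rw [lintegral_const_mul' _ _ ENNReal.ofReal_ne_top]
    simp_rw [hg]
    exact htime ξ hξ _ (by fun_prop) hGξ
  · have hGe' : Measurable fun z => G (e z) := hGm.comp e.measurable
    simp_rw [hez] at hGe' ⊢
    exact (Measurable.mul (by fun_prop) (hGe'.enorm.pow_const _)).aemeasurable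

theorem exists_l2lr_densFree_le {d : ℕ} (hd : 2 ≤ d) {α₁ α₂ : ℝ} (h₁ : 0 ≤ α₁) (h₂ : 0 ≤ α₂)
    (hsum : ((d : ℝ) - 1) / 2 < α₁ + α₂) :
    ∃ C : ℝ, 0 < C ∧ ∀ G : Vd d × Vd d → ℂ, Measurable G → Integrable G →
      l2lr (2 * d / ((d : ℝ) - 1)) Set.univ (densFree G) ≤
        ENNReal.ofReal C * wHSnorm α₂ α₁ G := by
  obtain ⟨n, rfl⟩ : ∃ n, d = n + 1 := ⟨d - 1, by omega⟩
  obtain ⟨C, hC, hsob⟩ := exists_sobolev_half_const hd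
  obtain ⟨K, hK, htime⟩ := exists_time_plancherel_const (n := n) h₁ h₂ (by
    push_cast at hsum; linarith)
  refine ⟨(C * (K + 1)) ^ (1 / 2 : ℝ), by positivity, fun G hGm hG => ?_⟩
  set p : ℝ := 2 * ((n + 1 : ℕ) : ℝ) / (((n + 1 : ℕ) : ℝ) - 1) with hp
  have hp0 : 0 ≤ p := by
    have : (2 : ℝ) ≤ ((n + 1 : ℕ) : ℝ) := by exact_mod_cast hd
    exact div_nonneg (by linarith) (by linarith)
  obtain ⟨e, he, hez⟩ := exists_measurableEquiv_shear (n + 1)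
  have hGe : Integrable (fun z => G (e z)) (volume.prod volume) :=
    he.integrable_comp_of_integrable hG
  set g : ℝ → Vd (n + 1) → ℂ := fun t ξ => ∫ η : Vd (n + 1),
    Complex.exp (-(Complex.I * Complex.ofReal (t * (‖η‖ ^ 2 - ‖ξ - η‖ ^ 2)))) * G (η, ξ - η)
    with hg
  have hgm : Measurable (Function.uncurry g) := by
    have : StronglyMeasurable fun q : (ℝ × Vd (n + 1)) × Vd (n + 1) =>
        Complex.exp (-(Complex.I * Complex.ofReal
          (q.1.1 * (‖q.2‖ ^ 2 - ‖q.1.2 - q.2‖ ^ 2)))) * G (q.2, q.1.2 - q.2) :=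
      Measurable.stronglyMeasurable (by fun_prop)
    exact this.integral_prod_right'.measurable
  have hgi : ∀ t, Integrable (g t) := fun t => by
    have h := (integrable_oscillatory hGe (a := fun z : Vd (n + 1) × Vd (n + 1) =>
      -(t * (‖z.2‖ ^ 2 - ‖z.1 - z.2‖ ^ 2))) (by fun_prop)).integral_prod_left
    simpa [hg, hez] using h
  have hle : ∀ t, (∫⁻ x : Vd (n + 1), ‖densFree G t x‖ₑ ^ p) ^ (2 / p) ≤
      ENNReal.ofReal C * ∫⁻ ξ, ENNReal.ofReal ‖ξ‖ * ‖g t ξ‖ₑ ^ (2 : ℝ) := fun t => by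
    refine le_trans ?_ (hsob (g t) (hgm.comp measurable_prodMk_left) (hgi t))
    refine ENNReal.rpow_le_rpow (lintegral_mono fun x => ENNReal.rpow_le_rpow ?_ hp0)
      (by positivity)
    rw [densFree_eq_oscillatory hG, enorm_smul]
    refine mul_le_of_le_one_left' ?_
    rw [← ofReal_norm, ENNReal.ofReal_le_one, norm_inv, norm_pow, Real.norm_of_nonneg (by positivity)]
    exact inv_le_one_of_one_le₀ (one_le_pow₀ (by linarith [Real.pi_gt_three]))
  have hmain : ∫⁻ t : ℝ, (∫⁻ x : Vd (n + 1), ‖densFree G t x‖ₑ ^ p) ^ (2 / p) ≤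
      ENNReal.ofReal (C * (K + 1)) * ∫⁻ p : Vd (n + 1) × Vd (n + 1),
        ENNReal.ofReal (jb p.1 ^ (2 * α₂) * jb p.2 ^ (2 * α₁)) * ‖G p‖ₑ ^ (2 : ℝ) := by
    refine (lintegral_mono hle).trans ?_
    rw [lintegral_const_mul' _ _ ENNReal.ofReal_ne_top, ENNReal.ofReal_mul hC.le, mul_assoc]
    refine mul_le_mul_right ((lintegral_half_derivative_le htime hGm hG hgm
      (fun _ _ => rfl)).trans (mul_le_mul_left ?_ _)) _
    exact ENNReal.ofReal_le_ofReal (by linarith)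
  unfold l2lr wHSnorm
  rw [← ENNReal.ofReal_rpow_of_nonneg (by positivity) (by positivity),
    ← ENNReal.mul_rpow_of_nonneg _ _ (by norm_num), Measure.restrict_univ]
  exact ENNReal.rpow_le_rpow hmain (by norm_num)

theorem densFree_congr_ae {d : ℕ} {G G' : Vd d × Vd d → ℂ} (h : G =ᵐ[volume] G') :
    densFree G = densFree G' := by
  ext t x
  unfold densFree
  congr 1
  refine integral_congr_ae ?_
  filter_upwards [h] with p hp
  rw [hp]

theorem wHSnorm_congr_ae {d : ℕ} {G G' : Vd d × Vd d → ℂ} (h : G =ᵐ[volume] G') (α₁ α₂ : ℝ) :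
    wHSnorm α₁ α₂ G = wHSnorm α₁ α₂ G' := by
  unfold wHSnorm
  congr 1
  refine lintegral_congr_ae ?_
  filter_upwards [h] with p hp
  rw [hp]

/-- If `G` is not integrable, the integral defining the density takes its default value. -/
theorem densFree_eq_zero_of_not_integrable {d : ℕ} {G : Vd d × Vd d → ℂ} (hG : ¬ Integrable G)
    (t : ℝ) (x : Vd d) : densFree G t x = 0 := by
  unfold densFree
  rw [integral_undef, smul_zero]
  intro h
  refine hG ?_
  have h' := integrable_oscillatory h (a := fun p : Vd d × Vd d =>
    -(⟪x, p.1 + p.2⟫ - t * (‖p.1‖ ^ 2 - ‖p.2‖ ^ 2))) (by fun_prop)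
  refine h'.congr (Eventually.of_forall fun p => ?_)
  simp only
  rw [← mul_assoc, ← Complex.exp_add, Complex.ofReal_neg, mul_neg, neg_add_cancel,
    Complex.exp_zero, one_mul]


/-- For `d ≥ 2` and admissible `α₀, α₁, α₂`, the density of the free
evolution satisfies `‖ρ_{e^{itΔ}γ₀e^{-itΔ}}‖_{L²_t L^{2d/(d-1)}_x} ≤ c ‖⟨∇⟩^{α₂} γ₀ ⟨∇⟩^{α₁}‖_{𝔖²}`
for every Hilbert–Schmidt operator `γ₀` (described through `G = γ̂₀`). -/
theorem density_strichartz_L2dOverDMinusOne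
    (d : ℕ) (hd : 2 ≤ d) (α₀ α₁ α₂ : ℝ) (h₀ : 0 ≤ α₀) (h₁ : 0 ≤ α₁) (h₂ : 0 ≤ α₂)
    (hsum : ((d:ℝ) - 1) / 2 < α₁ + α₂)
    (hc1 : max α₁ α₂ < ((d:ℝ) - 1) / 2 → α₀ = α₁ + α₂ - ((d:ℝ) - 1) / 2)
    (hc2 : max α₁ α₂ = ((d:ℝ) - 1) / 2 → α₀ < min α₁ α₂)
    (hc3 : ((d:ℝ) - 1) / 2 < max α₁ α₂ → α₀ = min α₁ α₂) :
    ∃ c : ℝ≥0, 0 < c ∧ ∀ G : Vd d × Vd d → ℂ, AEStronglyMeasurable G volume →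
      l2lr (2 * d / ((d:ℝ) - 1)) Set.univ (densFree G) ≤ c * wHSnorm α₂ α₁ G := by
  obtain ⟨C, hC, hle⟩ := exists_l2lr_densFree_le hd h₁ h₂ hsum
  refine ⟨C.toNNReal, Real.toNNReal_pos.2 hC, fun G hG => ?_⟩
  have hae : G =ᵐ[volume] hG.mk G := hG.ae_eq_mk
  by_cases hi : Integrable G
  · rw [densFree_congr_ae hae, wHSnorm_congr_ae hae]
    exact hle _ hG.stronglyMeasurable_mk.measurable (hi.congr hae)
  · have hd' : (2 : ℝ) ≤ d := by exact_mod_cast hd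
    have hp : 0 < 2 * (d : ℝ) / ((d : ℝ) - 1) := div_pos (by linarith) (by linarith)
    have h0 : l2lr (2 * d / ((d : ℝ) - 1)) Set.univ (densFree G) = 0 := by
      unfold l2lr
      simp_rw [densFree_eq_zero_of_not_integrable hi]
      simp only [nnnorm_zero, ENNReal.coe_zero, ENNReal.zero_rpow_of_pos hp, lintegral_zero,
        ENNReal.zero_rpow_of_pos (div_pos two_pos hp)]
      exact ENNReal.zero_rpow_of_pos (by norm_num)
    rw [h0]
    exact zero_le
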